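/- arXiv:1312.3721 — 2 statements merged into one kernel-verified Lean document; each statement's English description precedes it below -/
import Mathlib

section
/- Let f₁, …, f_k and f'₁, …, f'_k be two orthonormal families in ℝ^n related by a special orthogonal change of basis, i.e. f'_α = Σ_β g_{αβ} f_β for some matrix g ∈ SO(k). Then ĉ(f'₁) ∘ ⋯ ∘ ĉ(f'_k) = ĉ(f₁) ∘ ⋯ ∘ ĉ(f_k) as endomorphisms of ΛV; in other words, the operator ĉ(E, g^E) = ĉ(f₁)⋯ĉ(f_k) does not depend on the choice of oriented orthonormal basis of the subspace E spanned by f₁, …, f_k. -/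
open scoped RealInnerProductSpace

/-- Exterior multiplication `e ∧ ·` as an endomorphism of the exterior algebra `ΛV`
of `V = ℝⁿ`. -/
noncomputable def wedgeMul (n : ℕ) (e : EuclideanSpace ℝ (Fin n)) :
    Module.End ℝ (ExteriorAlgebra ℝ (EuclideanSpace ℝ (Fin n))) :=
  LinearMap.mulLeft ℝ (ExteriorAlgebra.ι ℝ e)

/-- Interior multiplication (contraction) `i_e` with respect to the standard inner
product, as an endomorphism of the exterior algebra `ΛV` of `V = ℝⁿ`. -/
noncomputable def intMul (n : ℕ) (e : EuclideanSpace ℝ (Fin n)) :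
    Module.End ℝ (ExteriorAlgebra ℝ (EuclideanSpace ℝ (Fin n))) :=
  CliffordAlgebra.contractLeft (Q := (0 : QuadraticForm ℝ (EuclideanSpace ℝ (Fin n))))
    (innerₗ (EuclideanSpace ℝ (Fin n)) e)

/-- The Clifford action `c(e) = e∧ − i_e`. -/
noncomputable def cOp (n : ℕ) (e : EuclideanSpace ℝ (Fin n)) :
    Module.End ℝ (ExteriorAlgebra ℝ (EuclideanSpace ℝ (Fin n))) :=
  wedgeMul n e - intMul n e

/-- The Clifford action `ĉ(e) = e∧ + i_e`. -/
noncomputable def chatOp (n : ℕ) (e : EuclideanSpace ℝ (Fin n)) :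
    Module.End ℝ (ExteriorAlgebra ℝ (EuclideanSpace ℝ (Fin n))) :=
  wedgeMul n e + intMul n e

/-- The operators `ĉ(e)` and `ĉ(e')` satisfy the Clifford relation
`ĉ(e)ĉ(e') + ĉ(e')ĉ(e) = 2⟨e, e'⟩`. -/
theorem chatOp_mul_add_chatOp_mul (n : ℕ) (e e' : EuclideanSpace ℝ (Fin n)) :
    chatOp n e * chatOp n e' + chatOp n e' * chatOp n e = (2 * ⟪e, e'⟫) • 1 := by
  refine LinearMap.ext fun x => ?_
  have hwedge : ExteriorAlgebra.ι ℝ e * (ExteriorAlgebra.ι ℝ e' * x)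
      = -(ExteriorAlgebra.ι ℝ e' * (ExteriorAlgebra.ι ℝ e * x)) := by
    rw [← mul_assoc, ← mul_assoc, ← neg_mul,
      eq_neg_of_add_eq_zero_left (ExteriorAlgebra.ι_add_mul_swap e e')]
  have hmixed (a b : EuclideanSpace ℝ (Fin n)) :
      intMul n a (ExteriorAlgebra.ι ℝ b * x)
        = ⟪a, b⟫ • x - ExteriorAlgebra.ι ℝ b * intMul n a x :=
    CliffordAlgebra.contractLeft_ι_mul _ _ _
  have hcontract : intMul n e (intMul n e' x) = -intMul n e' (intMul n e x) :=
    CliffordAlgebra.contractLeft_comm _ _ _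
  simp only [chatOp, wedgeMul, LinearMap.add_apply, Module.End.mul_apply,
    LinearMap.mulLeft_apply, LinearMap.smul_apply, Module.End.one_apply, mul_add, hwedge, hmixed,
    hcontract, real_inner_comm e e']
  module

/-- `ĉ` as a linear map in the vector. -/
noncomputable def chatLinear (n : ℕ) :
    EuclideanSpace ℝ (Fin n) →ₗ[ℝ]
      Module.End ℝ (ExteriorAlgebra ℝ (EuclideanSpace ℝ (Fin n))) where
  toFun := chatOp n
  map_add' a b := by
    refine LinearMap.ext fun x => ?_
    simp [chatOp, wedgeMul, intMul, add_mul]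
    abel
  map_smul' r a := by
    refine LinearMap.ext fun x => ?_
    simp [chatOp, wedgeMul, intMul]

/-- Exchanging two neighbouring factors of a product of anticommuting elements changes its
sign. -/
theorem prod_ofFn_swap_of_anticomm {R : Type*} [Ring R] {k : ℕ} (x : Fin (k + 1) → R)
    (hx : ∀ i j, i ≠ j → x i * x j = -(x j * x i)) (i : Fin k) :
    (List.ofFn (x ∘ Equiv.swap i.castSucc i.succ)).prod = -(List.ofFn x).prod := by
  induction k with
  | zero => exact i.elim0
  | succ k ih =>
    cases i using Fin.cases with
    | zero =>
      have hfix (j : Fin k) :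
          Equiv.swap (0 : Fin (k + 2)) (Fin.succ 0) j.succ.succ = j.succ.succ :=
        Equiv.swap_apply_of_ne_of_ne (Fin.succ_ne_zero _)
          fun h => Fin.succ_ne_zero _ (Fin.succ_injective _ h)
      simp only [List.ofFn_succ, List.prod_cons, Function.comp_apply, Fin.castSucc_zero, hfix,
        Equiv.swap_apply_left, Equiv.swap_apply_right]
      rw [← mul_assoc, ← mul_assoc, hx _ _ (Fin.succ_ne_zero 0), neg_mul]
    | succ i =>
      have hzero : Equiv.swap i.succ.castSucc i.succ.succ 0 = 0 :=
        Equiv.swap_apply_of_ne_of_ne (by simp [Fin.ext_iff]) (by simp [Fin.ext_iff])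
      have hsucc (j : Fin (k + 1)) : Equiv.swap i.succ.castSucc i.succ.succ j.succ
          = (Equiv.swap i.castSucc i.succ j).succ := by
        rw [← Fin.succ_castSucc]
        exact (Fin.succ_injective _).swap_apply _ _ _
      have := ih (x ∘ Fin.succ)
        (fun a b hab => hx _ _ fun h => hab (Fin.succ_injective _ h)) i
      rw [List.ofFn_succ (f := x), List.ofFn_succ (f := x ∘ _), List.prod_cons, List.prod_cons,
        ← mul_neg]
      simp only [Function.comp_apply, hzero, hsucc]
      exact congrArg (x 0 * ·) this

/-- Permuting the factors of a product of anticommuting elements multiplies it by the sign of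
the permutation. -/
theorem prod_ofFn_comp_perm_of_anticomm {R : Type*} [Ring R] {k : ℕ} (x : Fin k → R)
    (hx : ∀ i j, i ≠ j → x i * x j = -(x j * x i)) (σ : Equiv.Perm (Fin k)) :
    (List.ofFn (x ∘ σ)).prod = Equiv.Perm.sign σ • (List.ofFn x).prod := by
  cases k with
  | zero => simp [Subsingleton.elim σ 1]
  | succ k =>
    have hσ : σ ∈ Submonoid.closure
        (Set.range fun i : Fin k => Equiv.swap i.castSucc i.succ) := by
      rw [Equiv.Perm.mclosure_swap_castSucc_succ]; trivial
    induction hσ using Submonoid.closure_induction_right with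
    | one => simp
    | mul_right τ _ s hs ih =>
      obtain ⟨i, rfl⟩ := hs
      have := prod_ofFn_swap_of_anticomm (x ∘ τ)
        (fun a b hab => hx _ _ (τ.injective.ne hab)) i
      rw [Equiv.Perm.coe_mul, ← Function.comp_assoc, this, ih, Equiv.Perm.sign_mul,
        Equiv.Perm.sign_swap i.castSucc_lt_succ.ne]
      simp

/-- An alternating map evaluated on linear combinations of a family is the determinant of the
coefficients times its value on the family. -/
theorem AlternatingMap.map_sum_smul_eq_det_smul {R M N ι : Type*} [CommRing R] [AddCommGroup M]
    [Module R M] [AddCommGroup N] [Module R N] [Fintype ι] [DecidableEq ι]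
    (A : M [⋀^ι]→ₗ[R] N) (g : Matrix ι ι R) (v : ι → M) :
    A (fun i => ∑ j, g i j • v j) = g.det • A v := by
  have key : A.compLinearMap (Fintype.linearCombination R v)
      = Matrix.detRowAlternating.smulRight (A v) := by
    refine (Pi.basisFun R ι).ext_alternating fun w hw => ?_
    let σ : Equiv.Perm ι := Equiv.ofBijective w (Finite.injective_iff_bijective.mp hw)
    change (A.compLinearMap _) ((Pi.basisFun R ι) ∘ σ) =
      (Matrix.detRowAlternating.smulRight (A v)) ((Pi.basisFun R ι) ∘ σ)
    rw [AlternatingMap.map_perm, AlternatingMap.map_perm]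
    congr 1
    have hdet : Matrix.detRowAlternating (R := R) (Pi.basisFun R ι) = 1 := by
      rw [← Matrix.det_one (n := ι) (R := R)]
      exact congrArg Matrix.det (by ext i j; simp [Matrix.one_apply, Pi.single_apply, eq_comm])
    simp [Fintype.linearCombination_apply_single, hdet]
  exact DFunLike.congr_fun key g

/-- On an orthonormal family, antisymmetrizing the product of the `ĉ` multiplies it by `k!`. -/
theorem alternatization_chatProd_of_orthonormal (n k : ℕ) {f : Fin k → EuclideanSpace ℝ (Fin n)}
    (hf : Orthonormal ℝ f) :
    MultilinearMap.alternatization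
        ((MultilinearMap.mkPiAlgebraFin ℝ k _).compLinearMap fun _ => chatLinear n) f
      = k.factorial • (List.ofFn fun i => chatOp n (f i)).prod := by
  have hanti (i j : Fin k) (hij : i ≠ j) :
      chatOp n (f i) * chatOp n (f j) = -(chatOp n (f j) * chatOp n (f i)) := by
    apply eq_neg_of_add_eq_zero_left
    rw [chatOp_mul_add_chatOp_mul, hf.2 hij, mul_zero, zero_smul]
  have hperm (σ : Equiv.Perm (Fin k)) :
      (List.ofFn fun i => chatOp n (f (σ i))).prod
        = Equiv.Perm.sign σ • (List.ofFn fun i => chatOp n (f i)).prod :=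
    prod_ofFn_comp_perm_of_anticomm (fun i => chatOp n (f i)) hanti σ
  simp [MultilinearMap.alternatization_apply, chatLinear, hperm, smul_smul, Fintype.card_perm]

/-- for two orthonormal families `f`, `f'` in `ℝⁿ` related by a special
orthogonal change of basis `f'_α = Σ_β g_{αβ} f_β`, one has
`ĉ(f'₁)∘⋯∘ĉ(f'_k) = ĉ(f₁)∘⋯∘ĉ(f_k)`; i.e. `ĉ(E, g^E)` is independent of the choice of
oriented orthonormal basis. -/
theorem chatProd_basis_independent (n k : ℕ)
    (f f' : Fin k → EuclideanSpace ℝ (Fin n))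
    (hf : Orthonormal ℝ f) (hf' : Orthonormal ℝ f')
    (g : Matrix (Fin k) (Fin k) ℝ)
    (hg : g ∈ Matrix.specialOrthogonalGroup (Fin k) ℝ)
    (hrel : ∀ α : Fin k, f' α = ∑ β : Fin k, g α β • f β) :
    (List.ofFn fun i => chatOp n (f' i)).prod
      = (List.ofFn fun i => chatOp n (f i)).prod := by
  have halt := (MultilinearMap.alternatization
    ((MultilinearMap.mkPiAlgebraFin ℝ k _).compLinearMap fun _ => chatLinear n)
    ).map_sum_smul_eq_det_smul g f
  rw [← funext hrel, (Matrix.mem_specialOrthogonalGroup_iff.mp hg).2, one_smul,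
    alternatization_chatProd_of_orthonormal n k hf,
    alternatization_chatProd_of_orthonormal n k hf',
    ← Nat.cast_smul_eq_nsmul ℝ, ← Nat.cast_smul_eq_nsmul ℝ] at halt
  exact smul_right_injective _ (Nat.cast_ne_zero.mpr k.factorial_ne_zero) halt
end

section
/- Let e₁, …, e_n be the standard orthonormal basis of ℝ^n, and let 1 ≤ i₁ < ⋯ < i_p ≤ n and 1 ≤ j₁ < ⋯ < j_q ≤ n be strictly increasing index sequences. Then the supertrace Str[c(e_{i₁})∘⋯∘c(e_{i_p})∘ĉ(e_{j₁})∘⋯∘ĉ(e_{j_q})] equals (−1)^{n(n+1)/2}·2^n when p = q = n (so that both products run over the full basis e₁, …, e_n in order), and equals zero otherwise. -/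
open scoped RealInnerProductSpace

/-- The ℤ₂-grading operator `ε` of `ΛV`, acting as `+Id` on even-degree forms and
`−Id` on odd-degree forms (the grade involution, determined by `ι v ↦ −ι v`). -/
noncomputable def gradeOp (n : ℕ) :
    Module.End ℝ (ExteriorAlgebra ℝ (EuclideanSpace ℝ (Fin n))) :=
  (CliffordAlgebra.involute
    (Q := (0 : QuadraticForm ℝ (EuclideanSpace ℝ (Fin n))))).toLinearMap

/-- The supertrace `Str(A) = Tr(ε ∘ A)` of an endomorphism of `ΛV`. -/
noncomputable def superTrace (n : ℕ)
    (A : Module.End ℝ (ExteriorAlgebra ℝ (EuclideanSpace ℝ (Fin n)))) : ℝ :=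
  LinearMap.trace ℝ _ (gradeOp n * A)

/-- The standard orthonormal basis vector `e_i` of `ℝⁿ`. -/
noncomputable def stdVec (n : ℕ) (i : Fin n) : EuclideanSpace ℝ (Fin n) :=
  EuclideanSpace.single i (1 : ℝ)

theorem wedgeMul_mul_self (n : ℕ) (e : EuclideanSpace ℝ (Fin n)) :
    wedgeMul n e * wedgeMul n e = 0 := by
  refine LinearMap.ext fun x => ?_
  simp [wedgeMul, ← mul_assoc]

theorem wedgeMul_mul_wedgeMul (n : ℕ) (e f : EuclideanSpace ℝ (Fin n)) :
    wedgeMul n e * wedgeMul n f = (-1 : ℝ) • (wedgeMul n f * wedgeMul n e) := by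
  refine LinearMap.ext fun x => ?_
  have h := eq_neg_of_add_eq_zero_left (ExteriorAlgebra.ι_add_mul_swap (R := ℝ) e f)
  simp only [wedgeMul, Module.End.mul_apply, LinearMap.mulLeft_apply, LinearMap.smul_apply]
  rw [← mul_assoc, h, neg_mul, mul_assoc, neg_smul, one_smul]

theorem wedgeMul_eq_sum (n : ℕ) (v : EuclideanSpace ℝ (Fin n)) :
    wedgeMul n v = ∑ k, v k • wedgeMul n (stdVec n k) := by
  refine LinearMap.ext fun x => ?_
  conv_lhs => rw [← (EuclideanSpace.basisFun (Fin n) ℝ).sum_repr v]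
  simp [wedgeMul, stdVec, Finset.sum_mul]

theorem intMul_mul_self (n : ℕ) (e : EuclideanSpace ℝ (Fin n)) :
    intMul n e * intMul n e = 0 := by
  refine LinearMap.ext fun x => ?_
  exact CliffordAlgebra.contractLeft_contractLeft _ x

theorem intMul_mul_intMul (n : ℕ) (e f : EuclideanSpace ℝ (Fin n)) :
    intMul n e * intMul n f = (-1 : ℝ) • (intMul n f * intMul n e) := by
  refine LinearMap.ext fun x => ?_
  rw [LinearMap.smul_apply, neg_smul, one_smul]
  exact CliffordAlgebra.contractLeft_comm _ _ x

theorem intMul_mul_wedgeMul (n : ℕ) (e f : EuclideanSpace ℝ (Fin n)) :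
    intMul n e * wedgeMul n f = ⟪e, f⟫ • 1 - wedgeMul n f * intMul n e := by
  refine LinearMap.ext fun x => ?_
  exact CliffordAlgebra.contractLeft_ι_mul _ _ _

theorem gradeOp_mul_wedgeMul (n : ℕ) (e : EuclideanSpace ℝ (Fin n)) :
    gradeOp n * wedgeMul n e = (-1 : ℝ) • (wedgeMul n e * gradeOp n) := by
  refine LinearMap.ext fun x => ?_
  simp [gradeOp, wedgeMul]

theorem gradeOp_mul_intMul (n : ℕ) (e : EuclideanSpace ℝ (Fin n)) :
    gradeOp n * intMul n e = (-1 : ℝ) • (intMul n e * gradeOp n) := by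
  refine LinearMap.ext fun x => ?_
  induction x using CliffordAlgebra.left_induction with
  | algebraMap r => simp [gradeOp, intMul]
  | add x y hx hy => rw [map_add, map_add, hx, hy]
  | ι_mul x v hx =>
    simp only [gradeOp, intMul, Module.End.mul_apply, LinearMap.smul_apply, neg_smul, one_smul,
      AlgHom.toLinearMap_apply, CliffordAlgebra.contractLeft_ι_mul, map_sub, map_smul, map_mul,
      CliffordAlgebra.involute_ι, neg_mul, map_neg] at hx ⊢
    rw [hx]
    simp

theorem gradeOp_mul_self (n : ℕ) : gradeOp n * gradeOp n = 1 := by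
  refine LinearMap.ext fun x => ?_
  exact CliffordAlgebra.involute_involute x

theorem gradeOp_mul_cOp (n : ℕ) (e : EuclideanSpace ℝ (Fin n)) :
    gradeOp n * cOp n e = (-1 : ℝ) • (cOp n e * gradeOp n) := by
  simp only [cOp, mul_sub, sub_mul, gradeOp_mul_wedgeMul, gradeOp_mul_intMul, smul_sub]

theorem gradeOp_mul_chatOp (n : ℕ) (e : EuclideanSpace ℝ (Fin n)) :
    gradeOp n * chatOp n e = (-1 : ℝ) • (chatOp n e * gradeOp n) := by
  simp only [chatOp, mul_add, add_mul, gradeOp_mul_wedgeMul, gradeOp_mul_intMul, smul_add]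

/-- The Clifford relation for `c`. -/
theorem cOp_mul_cOp (n : ℕ) (e f : EuclideanSpace ℝ (Fin n)) :
    cOp n e * cOp n f = (-2 * ⟪e, f⟫) • 1 + (-1 : ℝ) • (cOp n f * cOp n e) := by
  simp only [cOp, mul_sub, sub_mul, intMul_mul_wedgeMul, wedgeMul_mul_wedgeMul n e f,
    intMul_mul_intMul n e f, real_inner_comm e f]
  module

/-- The Clifford relation for `ĉ`. -/
theorem chatOp_mul_chatOp (n : ℕ) (e f : EuclideanSpace ℝ (Fin n)) :
    chatOp n e * chatOp n f = (2 * ⟪e, f⟫) • 1 + (-1 : ℝ) • (chatOp n f * chatOp n e) := by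
  simp only [chatOp, mul_add, add_mul, intMul_mul_wedgeMul, wedgeMul_mul_wedgeMul n e f,
    intMul_mul_intMul n e f, real_inner_comm e f]
  module

theorem cOp_mul_chatOp (n : ℕ) (e f : EuclideanSpace ℝ (Fin n)) :
    cOp n e * chatOp n f = (-1 : ℝ) • (chatOp n f * cOp n e) := by
  simp only [cOp, chatOp, mul_add, add_mul, mul_sub, sub_mul, intMul_mul_wedgeMul,
    wedgeMul_mul_wedgeMul n e f, intMul_mul_intMul n e f, real_inner_comm e f]
  module

theorem chatOp_mul_cOp (n : ℕ) (e f : EuclideanSpace ℝ (Fin n)) :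
    chatOp n e * cOp n f = (-1 : ℝ) • (cOp n f * chatOp n e) := by
  rw [cOp_mul_chatOp, smul_smul]
  norm_num

theorem cOp_mul_chatOp_self (n : ℕ) (e : EuclideanSpace ℝ (Fin n)) :
    cOp n e * chatOp n e = (2 : ℝ) • (wedgeMul n e * intMul n e) - ⟪e, e⟫ • 1 := by
  simp only [cOp, chatOp, mul_add, sub_mul, intMul_mul_wedgeMul, wedgeMul_mul_self,
    intMul_mul_self]
  module

theorem inner_stdVec (n : ℕ) (a b : Fin n) :
    ⟪stdVec n a, stdVec n b⟫ = if a = b then 1 else 0 := by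
  simp [stdVec, EuclideanSpace.inner_single_left, PiLp.single_apply]

theorem cOp_stdVec_mul_self (n : ℕ) (k : Fin n) :
    cOp n (stdVec n k) * cOp n (stdVec n k) = (-1 : ℝ) • 1 := by
  simp only [cOp, mul_sub, sub_mul, intMul_mul_wedgeMul, wedgeMul_mul_self, intMul_mul_self,
    inner_stdVec, if_true]
  module

theorem chatOp_stdVec_mul_self (n : ℕ) (k : Fin n) :
    chatOp n (stdVec n k) * chatOp n (stdVec n k) = (1 : ℝ) • 1 := by
  simp only [chatOp, mul_add, add_mul, intMul_mul_wedgeMul, wedgeMul_mul_self, intMul_mul_self,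
    inner_stdVec, if_true]
  module

theorem cOp_mul_cOp_of_ne (n : ℕ) {a b : Fin n} (h : a ≠ b) :
    cOp n (stdVec n a) * cOp n (stdVec n b) =
      (-1 : ℝ) • (cOp n (stdVec n b) * cOp n (stdVec n a)) := by
  rw [cOp_mul_cOp, inner_stdVec, if_neg h, mul_zero, zero_smul, zero_add]

theorem chatOp_mul_chatOp_of_ne (n : ℕ) {a b : Fin n} (h : a ≠ b) :
    chatOp n (stdVec n a) * chatOp n (stdVec n b) =
      (-1 : ℝ) • (chatOp n (stdVec n b) * chatOp n (stdVec n a)) := by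
  rw [chatOp_mul_chatOp, inner_stdVec, if_neg h, mul_zero, zero_smul, zero_add]

/-- An element anticommuting with every factor of a product commutes with the product
up to the sign given by the number of factors. -/
theorem mul_list_prod_of_anticommute {R : Type*} [Semiring R] [Algebra ℝ R] (x : R) (l : List R)
    (h : ∀ y ∈ l, x * y = (-1 : ℝ) • (y * x)) :
    x * l.prod = (-1 : ℝ) ^ l.length • (l.prod * x) := by
  induction l with
  | nil => simp
  | cons a l ih =>
    have hl := ih fun y hy => h y (List.mem_cons_of_mem _ hy)
    rw [List.prod_cons, ← mul_assoc, h a List.mem_cons_self, smul_mul_assoc, mul_assoc, hl,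
      List.length_cons, pow_succ', mul_smul_comm, smul_smul, mul_assoc]

theorem trace_eq_zero_of_anticommute {M : Type*} [AddCommMonoid M] [Module ℝ M]
    (X A : Module.End ℝ M) {s : ℝ} (hs : s ≠ 0) (hX : X * X = s • 1)
    (h : X * A = (-1 : ℝ) • (A * X)) : LinearMap.trace ℝ M A = 0 := by
  have h1 : LinearMap.trace ℝ M (X * A * X) = s * LinearMap.trace ℝ M A := by
    rw [LinearMap.trace_mul_comm, ← mul_assoc, hX, smul_mul_assoc, one_mul, map_smul, smul_eq_mul]
  have h2 : LinearMap.trace ℝ M (X * A * X) = -1 * (s * LinearMap.trace ℝ M A) := by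
    rw [h, smul_mul_assoc, mul_assoc, hX, mul_smul_comm, mul_one, map_smul, map_smul, smul_eq_mul,
      smul_eq_mul]
  have h3 : s * LinearMap.trace ℝ M A = 0 := by linarith
  exact (mul_eq_zero.mp h3).resolve_left hs

theorem list_prod_mul_list_prod_of_anticommute {ι R : Type*} [Semiring R] [Algebra ℝ R]
    (c d : ι → R) (h : ∀ a b, d b * c a = (-1 : ℝ) • (c a * d b)) (l : List ι) :
    (l.map c).prod * (l.map d).prod =
      (-1 : ℝ) ^ l.length.choose 2 • (l.map fun a => c a * d a).prod := by
  induction l with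
  | nil => simp
  | cons a l ih =>
    have hd := mul_list_prod_of_anticommute (d a) (l.map c) (by
      simp only [List.mem_map]
      rintro _ ⟨b, -, rfl⟩
      exact h b a)
    have hc : (l.map c).prod * d a = (-1 : ℝ) ^ l.length • (d a * (l.map c).prod) := by
      rw [hd, List.length_map, smul_smul, ← pow_add, Even.neg_one_pow ⟨_, rfl⟩, one_smul]
    simp only [List.map_cons, List.prod_cons, List.length_cons]
    calc c a * (l.map c).prod * (d a * (l.map d).prod)
        = c a * ((l.map c).prod * d a) * (l.map d).prod := by simp only [mul_assoc]
      _ = (-1 : ℝ) ^ l.length • (c a * d a * ((l.map c).prod * (l.map d).prod)) := by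
          rw [hc, mul_smul_comm, smul_mul_assoc]; simp only [mul_assoc]
      _ = _ := by
          rw [ih, mul_smul_comm, smul_smul, ← pow_add, Nat.choose_succ_succ' l.length 1,
            Nat.choose_one_right]

theorem cOp_mul_chatOp_mul_wedgeMul (n : ℕ) (a k : Fin n) :
    cOp n (stdVec n a) * chatOp n (stdVec n a) * wedgeMul n (stdVec n k) =
      (if a = k then -1 else 1 : ℝ) •
        (wedgeMul n (stdVec n k) * (cOp n (stdVec n a) * chatOp n (stdVec n a))) := by
  rw [cOp_mul_chatOp_self, sub_mul, smul_mul_assoc, mul_assoc, intMul_mul_wedgeMul, mul_sub,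
    mul_sub, mul_smul_comm, mul_smul_comm, mul_smul_comm, ← mul_assoc (wedgeMul _ _),
    ← mul_assoc (wedgeMul _ _), inner_stdVec, inner_stdVec, if_pos (rfl : a = a)]
  split_ifs with h
  · subst h
    simp only [wedgeMul_mul_self, zero_mul, smul_mul_assoc, one_mul, mul_one]
    module
  · simp only [wedgeMul_mul_wedgeMul n (stdVec n a) (stdVec n k), smul_mul_assoc, one_mul, mul_one]
    module

theorem list_prod_mul_wedgeMul (n : ℕ) (l : List (Fin n)) (k : Fin n) :
    (l.map fun a => cOp n (stdVec n a) * chatOp n (stdVec n a)).prod * wedgeMul n (stdVec n k) =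
      (-1 : ℝ) ^ l.count k • (wedgeMul n (stdVec n k) *
        (l.map fun a => cOp n (stdVec n a) * chatOp n (stdVec n a)).prod) := by
  induction l with
  | nil => simp
  | cons a l ih =>
    rw [List.map_cons, List.prod_cons, mul_assoc, ih, mul_smul_comm, ← mul_assoc,
      cOp_mul_chatOp_mul_wedgeMul, smul_mul_assoc, smul_smul, List.count_cons, mul_assoc]
    by_cases h : a = k <;> simp only [h, beq_iff_eq, if_true, if_false, pow_succ, add_zero, mul_one]

theorem list_prod_apply_one (n : ℕ) (l : List (Fin n)) :
    (l.map fun a => cOp n (stdVec n a) * chatOp n (stdVec n a)).prod 1 =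
      (-1 : ℝ) ^ l.length • 1 := by
  induction l with
  | nil => simp
  | cons a l ih =>
    have h : (cOp n (stdVec n a) * chatOp n (stdVec n a)) 1 = (-1 : ℝ) • 1 := by
      rw [cOp_mul_chatOp_self, inner_stdVec]
      simp [intMul]
    rw [List.map_cons, List.prod_cons, Module.End.mul_apply, ih, map_smul, h, smul_smul,
      List.length_cons, pow_succ]

theorem finRange_prod_eq_gradeOp (n : ℕ) :
    ((List.finRange n).map fun a => cOp n (stdVec n a) * chatOp n (stdVec n a)).prod =
      (-1 : ℝ) ^ n • gradeOp n := by
  set P := ((List.finRange n).map fun a => cOp n (stdVec n a) * chatOp n (stdVec n a)).prod with hP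
  have hw (v : EuclideanSpace ℝ (Fin n)) :
      P * wedgeMul n v = (-1 : ℝ) • (wedgeMul n v * P) := by
    simp only [wedgeMul_eq_sum n v, Finset.mul_sum, Finset.sum_mul, mul_smul_comm,
      smul_mul_assoc, Finset.smul_sum]
    refine Finset.sum_congr rfl fun k _ => ?_
    rw [hP, list_prod_mul_wedgeMul,
      List.count_eq_one_of_mem (List.nodup_finRange n) (List.mem_finRange k), pow_one, smul_comm]
  refine LinearMap.ext fun x => ?_
  induction x using CliffordAlgebra.left_induction with
  | algebraMap r =>
    rw [Algebra.algebraMap_eq_smul_one, map_smul, map_smul]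
    congr 1
    refine (list_prod_apply_one n _).trans ?_
    simp [gradeOp]
  | add x y hx hy => rw [map_add, map_add, hx, hy]
  | ι_mul x v hx =>
    have h2 := LinearMap.congr_fun (hw v) x
    have h3 := LinearMap.congr_fun (gradeOp_mul_wedgeMul n v) x
    simp only [Module.End.mul_apply, LinearMap.smul_apply] at h2 h3 hx
    change P (wedgeMul n v x) = (-1 : ℝ) ^ n • gradeOp n (wedgeMul n v x)
    rw [h2, h3, hx, map_smul, smul_comm]

theorem trace_one_exteriorAlgebra (n : ℕ) :
    LinearMap.trace ℝ (ExteriorAlgebra ℝ (EuclideanSpace ℝ (Fin n))) 1 = 2 ^ n := by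
  have b := (EuclideanSpace.basisFun (Fin n) ℝ).toBasis.ExteriorAlgebra
  have := Module.Finite.of_basis b
  rw [LinearMap.trace_one, Module.finrank_eq_card_basis b]
  simp

theorem superTrace_top (n : ℕ) :
    superTrace n (((List.finRange n).map fun a => cOp n (stdVec n a)).prod *
        ((List.finRange n).map fun a => chatOp n (stdVec n a)).prod) =
      (-1 : ℝ) ^ (n * (n + 1) / 2) * 2 ^ n := by
  have he : n * (n + 1) / 2 = n.choose 2 + n := by
    have h := Nat.choose_two_right (n + 1)
    rw [Nat.choose_succ_succ' n 1, Nat.choose_one_right, Nat.add_sub_cancel] at h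
    rw [mul_comm, ← h, add_comm]
  rw [superTrace, list_prod_mul_list_prod_of_anticommute _ _ fun _ _ => chatOp_mul_cOp _ _ _,
    finRange_prod_eq_gradeOp, List.length_finRange, smul_smul, ← pow_add, ← he, mul_smul_comm,
    gradeOp_mul_self, map_smul, trace_one_exteriorAlgebra, smul_eq_mul]

theorem exists_notMem_range_of_lt {n p : ℕ} (i : Fin p → Fin n) (h : p < n) :
    ∃ k, ∀ a, i a ≠ k := by
  by_contra! hk
  exact h.not_ge (by simpa using Fintype.card_le_of_surjective i hk)

/-- for strictly increasing index sequences `i₁ < ⋯ < i_p` and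
`j₁ < ⋯ < j_q` in `{1, …, n}`,
`Str[c(e_{i₁})⋯c(e_{i_p})ĉ(e_{j₁})⋯ĉ(e_{j_q})] = (−1)^{n(n+1)/2}·2ⁿ` if `p = q = n`,
and `= 0` otherwise. -/
theorem superTrace_clifford_product (n p q : ℕ)
    (i : Fin p → Fin n) (j : Fin q → Fin n)
    (hi : StrictMono i) (hj : StrictMono j) :
    superTrace n
      ((List.ofFn fun a => cOp n (stdVec n (i a))).prod *
        (List.ofFn fun a => chatOp n (stdVec n (j a))).prod)
      = if p = n ∧ q = n then (-1 : ℝ) ^ (n * (n + 1) / 2) * 2 ^ n else 0 := by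
  split_ifs with hpq
  · obtain ⟨rfl, rfl⟩ := hpq
    obtain rfl := hi.eq_id
    obtain rfl := hj.eq_id
    rw [List.ofFn_eq_map, List.ofFn_eq_map]
    exact superTrace_top _
  · set C := List.ofFn fun a => cOp n (stdVec n (i a)) with hC
    set D := List.ofFn fun a => chatOp n (stdVec n (j a)) with hD
    have hp : p ≤ n := by simpa using Fintype.card_le_of_injective i hi.injective
    have hq : q ≤ n := by simpa using Fintype.card_le_of_injective j hj.injective
    rw [superTrace, ← List.prod_append]
    rcases Nat.even_or_odd (p + q) with hev | hodd
    · have anti (X) (hX : ∀ y ∈ gradeOp n :: (C ++ D), X * y = (-1 : ℝ) • (y * X)) :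
          X * (gradeOp n * (C ++ D).prod) = (-1 : ℝ) • (gradeOp n * (C ++ D).prod * X) := by
        have hlen : Odd (gradeOp n :: (C ++ D)).length := by
          simpa [hC, hD] using hev.add_one
        rw [← List.prod_cons, mul_list_prod_of_anticommute X _ hX, hlen.neg_one_pow]
      rcases hp.lt_or_eq with hp | rfl
      · obtain ⟨k, hk⟩ := exists_notMem_range_of_lt i hp
        refine trace_eq_zero_of_anticommute (cOp n (stdVec n k)) _ (s := -1) (by norm_num)
          (cOp_stdVec_mul_self _ _) (anti _ ?_)
        simp only [List.mem_cons, List.mem_append, hC, hD, List.mem_ofFn]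
        rintro _ (rfl | ⟨a, rfl⟩ | ⟨a, rfl⟩)
        · rw [gradeOp_mul_cOp, smul_smul]; norm_num
        · exact cOp_mul_cOp_of_ne _ (hk a).symm
        · exact cOp_mul_chatOp _ _ _
      · obtain ⟨k, hk⟩ := exists_notMem_range_of_lt j
          (hq.lt_of_ne fun h => hpq ⟨rfl, h⟩)
        refine trace_eq_zero_of_anticommute (chatOp p (stdVec p k)) _ one_ne_zero
          (chatOp_stdVec_mul_self _ _) (anti _ ?_)
        simp only [List.mem_cons, List.mem_append, hC, hD, List.mem_ofFn]
        rintro _ (rfl | ⟨a, rfl⟩ | ⟨a, rfl⟩)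
        · rw [gradeOp_mul_chatOp, smul_smul]; norm_num
        · exact chatOp_mul_cOp _ _ _
        · exact chatOp_mul_chatOp_of_ne _ (hk a).symm
    · refine trace_eq_zero_of_anticommute (gradeOp n) _ one_ne_zero
        (by rw [gradeOp_mul_self, one_smul]) ?_
      have hlen : Odd (C ++ D).length := by simpa [hC, hD] using hodd
      have h := mul_list_prod_of_anticommute (gradeOp n) (C ++ D) (by
        simp only [List.mem_append, hC, hD, List.mem_ofFn]
        rintro _ (⟨a, rfl⟩ | ⟨a, rfl⟩)
        · exact gradeOp_mul_cOp _ _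
        · exact gradeOp_mul_chatOp _ _)
      rw [hlen.neg_one_pow] at h
      rw [mul_assoc, ← mul_smul_comm, ← h]
end
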